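/- arXiv:math/9804125 — 3 statements merged into one kernel-verified Lean document; each statement's English description precedes it below -/
import Mathlib

section
/- Let Ω ⊂ ℝ^N be open, let u : Ω → ℝ be a C² function with ∇u(x) ≠ 0 for every x ∈ Ω, set q(x) = |∇u(x)|, and let ψ : (0,∞) → ℝ be a C¹ function. Then at every point of Ω: ψ(q)² Σ_{i,h=1}^N (u_{ih})² ≥ (ψ(q)² − ψ'(q)² q²) |∇q|² + (2ψ'(q)q − 2ψ(q)) ⟨∇q, ∇u⟩ − N q² + 2 ψ(q) q Δu. -/
open Set
open scoped RealInnerProductSpace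

noncomputable section

/-- The `i`-th standard basis vector of `ℝ^N`. -/
def eb (N : ℕ) (i : Fin N) : EuclideanSpace ℝ (Fin N) := EuclideanSpace.single i 1

/-- Second partial derivative `u_{ih} = ∂²u/∂x^i∂x^h`. -/
def pd2 {N : ℕ} (u : EuclideanSpace ℝ (Fin N) → ℝ) (x : EuclideanSpace ℝ (Fin N))
    (i h : Fin N) : ℝ :=
  fderiv ℝ (fun y => fderiv ℝ u y (eb N h)) x (eb N i)

/-- The Laplacian `Δu = Σᵢ u_{ii}`. -/
def lap {N : ℕ} (u : EuclideanSpace ℝ (Fin N) → ℝ) (x : EuclideanSpace ℝ (Fin N)) : ℝ :=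
  ∑ i, pd2 u x i i

/-- The gradient modulus `q = |∇u|`. -/
def qf {N : ℕ} (u : EuclideanSpace ℝ (Fin N) → ℝ) (x : EuclideanSpace ℝ (Fin N)) : ℝ :=
  ‖gradient u x‖

theorem gradient_apply_eq_fderiv {N : ℕ} (f : EuclideanSpace ℝ (Fin N) → ℝ)
    (x : EuclideanSpace ℝ (Fin N)) (i : Fin N) : gradient f x i = fderiv ℝ f x (eb N i) := by
  have h : ⟪gradient f x, eb N i⟫ = fderiv ℝ f x (eb N i) := by
    simp [gradient]
  rw [← h, eb, EuclideanSpace.inner_single_right]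
  simp

theorem qf_mul_gradient_qf_apply {N : ℕ} {u : EuclideanSpace ℝ (Fin N) → ℝ}
    {x : EuclideanSpace ℝ (Fin N)} (hu : ContDiffAt ℝ 2 u x) (hx : gradient u x ≠ 0)
    (i : Fin N) :
    qf u x * gradient (qf u) x i = ∑ h, pd2 u x i h * gradient u x h := by
  have hd : DifferentiableAt ℝ (fderiv ℝ u) x :=
    (hu.fderiv_right (m := 1) (by norm_num)).differentiableAt (by norm_num)
  have hg : DifferentiableAt ℝ (gradient u) x :=
    (InnerProductSpace.toDual ℝ (EuclideanSpace ℝ (Fin N))).symm.toContinuousLinearEquiv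
      |>.differentiableAt.comp x hd
  have hq : DifferentiableAt ℝ (qf u) x := hg.norm ℝ hx
  have hsq : (fun y => qf u y ^ 2) = fun y => ∑ h, fderiv ℝ u y (eb N h) ^ 2 := by
    funext y
    simp [qf, EuclideanSpace.real_norm_sq_eq, gradient_apply_eq_fderiv]
  have hpart (h : Fin N) : HasFDerivAt (fun y => fderiv ℝ u y (eb N h))
      (fderiv ℝ (fun y => fderiv ℝ u y (eb N h)) x) x :=
    (hd.clm_apply (differentiableAt_const _)).hasFDerivAt
  have hsum : HasFDerivAt (fun y => qf u y ^ 2)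
      (∑ h, (2 * fderiv ℝ u x (eb N h)) • fderiv ℝ (fun y => fderiv ℝ u y (eb N h)) x) x := by
    rw [hsq]
    exact HasFDerivAt.fun_sum fun h _ => by simpa using (hpart h).pow 2
  have key := congrArg (fun L : EuclideanSpace ℝ (Fin N) →L[ℝ] ℝ => L (eb N i))
    ((hq.hasFDerivAt.pow 2).unique hsum)
  simp only [gradient_apply_eq_fderiv, pd2]
  simp [mul_assoc, ← Finset.mul_sum] at key
  rw [key]
  exact Finset.sum_congr rfl fun h _ => mul_comm _ _

/-- The squared Frobenius norm of `a H + c p ⊗ n - q I`, where `p = H n`. -/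
theorem sum_sq_add_rank_one_sub_scalar {ι : Type*} [Fintype ι] [DecidableEq ι]
    (H : ι → ι → ℝ) (p n : ι → ℝ) (a c q : ℝ) (hn : ∑ h, n h ^ 2 = 1)
    (hp : ∀ i, p i = ∑ h, H i h * n h) :
    ∑ i, ∑ h, (a * H i h + c * (p i * n h) - q * if i = h then 1 else 0) ^ 2 =
      a ^ 2 * ∑ i, ∑ h, H i h ^ 2 + (c ^ 2 + 2 * a * c) * ∑ i, p i ^ 2
        + Fintype.card ι * q ^ 2 - 2 * a * q * ∑ i, H i i - 2 * q * c * ∑ i, p i * n i := by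
  have hrow (i : ι) :
      ∑ h, (a * H i h + c * (p i * n h) - q * if i = h then 1 else 0) ^ 2 =
        a ^ 2 * ∑ h, H i h ^ 2 + (c ^ 2 + 2 * a * c) * p i ^ 2
          + q ^ 2 - 2 * a * q * H i i - 2 * q * c * (p i * n i) := by
    have hterm (h : ι) :
        (a * H i h + c * (p i * n h) - q * if i = h then 1 else 0) ^ 2 =
          a ^ 2 * H i h ^ 2 + c ^ 2 * p i ^ 2 * n h ^ 2 + 2 * a * c * p i * (H i h * n h)
            + if i = h then q ^ 2 - 2 * a * q * H i h - 2 * q * c * (p i * n h) else 0 := by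
      split_ifs <;> ring
    simp only [hterm, Finset.sum_add_distrib, ← Finset.mul_sum, hn, ← hp,
      Finset.sum_ite_eq, Finset.mem_univ, if_true]
    ring
  simp only [hrow, Finset.sum_sub_distrib, Finset.sum_add_distrib, ← Finset.mul_sum,
    Finset.sum_const, Finset.card_univ, nsmul_eq_mul]

/-- Paper's Lemma 2.2, inequality (2.1): for a `C²` function `u` with nonvanishing
gradient on an open set `Ω ⊂ ℝ^N`, `q = |∇u|`, and a `C¹` function `ψ` on `(0,∞)`,
`ψ(q)² Σ_{i,h} u_{ih}² ≥ (ψ(q)² − ψ'(q)² q²)|∇q|² + (2ψ'(q)q − 2ψ(q))⟨∇q, ∇u⟩ − N q²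
+ 2 ψ(q) q Δu` at every point of `Ω`. -/
theorem stmt1 (N : ℕ) (Ω : Set (EuclideanSpace ℝ (Fin N))) (hΩ : IsOpen Ω)
    (u : EuclideanSpace ℝ (Fin N) → ℝ) (hu : ContDiffOn ℝ 2 u Ω)
    (hgrad : ∀ x ∈ Ω, gradient u x ≠ 0)
    (ψ : ℝ → ℝ) (hψ : ContDiffOn ℝ 1 ψ (Ioi 0)) :
    ∀ x ∈ Ω,
      (ψ (qf u x))^2 * (∑ i, ∑ h, (pd2 u x i h)^2) ≥
        ((ψ (qf u x))^2 - (deriv ψ (qf u x))^2 * (qf u x)^2) * ‖gradient (qf u) x‖^2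
        + (2 * deriv ψ (qf u x) * qf u x - 2 * ψ (qf u x)) * ⟪gradient (qf u) x, gradient u x⟫
        - (N : ℝ) * (qf u x)^2 + 2 * ψ (qf u x) * qf u x * lap u x := by
  intro x hx
  have hq : 0 < qf u x := norm_pos_iff.mpr (hgrad x hx)
  have hqsq : ∑ h, gradient u x h ^ 2 = qf u x ^ 2 := by
    simp [qf, EuclideanSpace.real_norm_sq_eq]
  have hn : ∑ h, (gradient u x h / qf u x) ^ 2 = 1 := by
    simp only [div_pow, ← Finset.sum_div, hqsq]
    exact div_self (by positivity)
  have hp (i : Fin N) :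
      gradient (qf u) x i = ∑ h, pd2 u x i h * (gradient u x h / qf u x) := by
    simp only [← mul_div_assoc, ← Finset.sum_div]
    rw [← qf_mul_gradient_qf_apply (hu.contDiffAt (hΩ.mem_nhds hx)) (hgrad x hx) i,
      mul_div_cancel_left₀ _ hq.ne']
  have hinner : ⟪gradient (qf u) x, gradient u x⟫ =
      qf u x * ∑ i, gradient (qf u) x i * (gradient u x i / qf u x) := by
    rw [PiLp.inner_apply, Finset.mul_sum]
    refine Finset.sum_congr rfl fun i _ => ?_
    simp only [RCLike.inner_apply, conj_trivial]
    field_simp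
  have key := sum_sq_add_rank_one_sub_scalar (pd2 u x) (fun i => gradient (qf u) x i)
    (fun h => gradient u x h / qf u x) (ψ (qf u x))
    (deriv ψ (qf u x) * qf u x - ψ (qf u x)) (qf u x) hn hp
  have hnonneg := key ▸ Finset.sum_nonneg fun i _ => Finset.sum_nonneg fun h _ => sq_nonneg _
  rw [hinner, EuclideanSpace.real_norm_sq_eq, lap]
  rw [Fintype.card_fin] at hnonneg
  linarith

end
end

section
/- Let Ω ⊂ ℝ^N be open and connected, let u : Ω → ℝ be a C² function with ∇u(x) ≠ 0 for every x ∈ Ω, set q(x) = |∇u(x)|, and let ψ : (0,∞) → ℝ be a C¹ function. If equality holds at every point of Ω in the inequality ψ(q)² Σ_{i,h=1}^N (u_{ih})² ≥ (ψ(q)² − ψ'(q)² q²) |∇q|² + (2ψ'(q)q − 2ψ(q)) ⟨∇q, ∇u⟩ − N q² + 2 ψ(q) q Δu, then there exists a point x₀ ∈ ℝ^N such that (ψ(q(x))/q(x)) ∇u(x) = x − x₀ for all x ∈ Ω, and consequently ψ(q(x))² = |x − x₀|² for all x ∈ Ω. -/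
open Set
open scoped RealInnerProductSpace

noncomputable section

/-- The gradient of a `C²` function on an open set is differentiable there. -/
theorem differentiableAt_gradient {N : ℕ} {Ω : Set (EuclideanSpace ℝ (Fin N))} (hΩ : IsOpen Ω)
    {u : EuclideanSpace ℝ (Fin N) → ℝ} (hu : ContDiffOn ℝ 2 u Ω)
    {x : EuclideanSpace ℝ (Fin N)} (hx : x ∈ Ω) : DifferentiableAt ℝ (gradient u) x := by
  have h1 : DifferentiableAt ℝ (fderiv ℝ u) x :=
    ((hu.fderiv_of_isOpen (m := 1) hΩ (by norm_num)).differentiableOn (by norm_num)).differentiableAt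
      (hΩ.mem_nhds hx)
  exact ((InnerProductSpace.toDual ℝ (EuclideanSpace ℝ (Fin N))).symm.toContinuousLinearEquiv
    |>.differentiableAt).comp x h1

/-- Second partial derivatives are the matrix entries of the derivative of the gradient. -/
theorem pd2_eq_inner {N : ℕ} {u : EuclideanSpace ℝ (Fin N) → ℝ} {x : EuclideanSpace ℝ (Fin N)}
    (hG : DifferentiableAt ℝ (gradient u) x) (i h : Fin N) :
    pd2 u x i h = ⟪fderiv ℝ (gradient u) x (eb N i), eb N h⟫ := by
  have h1 : (fun y => fderiv ℝ u y (eb N h)) = fun y => ⟪gradient u y, eb N h⟫ := by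
    funext y
    rw [inner_gradient_left]
  rw [pd2, h1, fderiv_inner_apply ℝ hG (differentiableAt_const _)]
  simp

/-- The chain rule for the gradient modulus. -/
theorem qf_mul_inner_gradient_qf {N : ℕ} {u : EuclideanSpace ℝ (Fin N) → ℝ}
    {x : EuclideanSpace ℝ (Fin N)} (hG : DifferentiableAt ℝ (gradient u) x)
    (h0 : gradient u x ≠ 0) (v : EuclideanSpace ℝ (Fin N)) :
    qf u x * ⟪gradient (qf u) x, v⟫ = ⟪fderiv ℝ (gradient u) x v, gradient u x⟫ := by
  have hq : DifferentiableAt ℝ (qf u) x := hG.norm ℝ h0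
  have h1 : (fun y => qf u y ^ 2) = fun y => ‖gradient u y‖ ^ 2 := rfl
  have h2 := hq.hasFDerivAt.pow 2
  rw [h1] at h2
  have h3 := congrArg (fun L => L v) (h2.unique hG.hasFDerivAt.norm_sq)
  rw [inner_gradient_left, real_inner_comm, inner_gradient_left]
  simp only [smul_apply, ContinuousLinearMap.comp_apply, innerSL_apply_apply,
    inner_gradient_left, pow_one, Nat.add_one_sub_one, nsmul_eq_mul, smul_eq_mul,
    Nat.cast_ofNat] at h3
  linarith

/-- Pointwise expansion of the squared Hilbert–Schmidt norm of a rank-one perturbation of a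
multiple of `L`, minus the identity. -/
theorem sum_norm_sq_rank_one_perturbation_sub_id {N : ℕ}
    (L : EuclideanSpace ℝ (Fin N) →L[ℝ] EuclideanSpace ℝ (Fin N))
    (g p : EuclideanSpace ℝ (Fin N)) (q a c : ℝ) (hq : ‖g‖ = q)
    (hL : ∀ v, q * ⟪p, v⟫ = ⟪L v, g⟫) :
    ∑ i, ‖a • L (eb N i) + (c * ⟪p, eb N i⟫) • g - eb N i‖ ^ 2 =
      a ^ 2 * (∑ i, ∑ h, ⟪L (eb N i), eb N h⟫ ^ 2) + (c ^ 2 * q ^ 2 + 2 * a * c * q) * ‖p‖ ^ 2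
        - 2 * a * (∑ i, ⟪L (eb N i), eb N i⟫) - 2 * c * ⟪p, g⟫ + N := by
  have hsq (v : EuclideanSpace ℝ (Fin N)) : ∑ h, ⟪v, eb N h⟫ ^ 2 = ‖v‖ ^ 2 := by
    simp [eb, EuclideanSpace.norm_sq_eq, EuclideanSpace.inner_single_right]
  have hpg : ∑ i, ⟪p, eb N i⟫ * ⟪g, eb N i⟫ = ⟪p, g⟫ := by
    simp [eb, PiLp.inner_apply, mul_comm]
  have key (i : Fin N) : ‖a • L (eb N i) + (c * ⟪p, eb N i⟫) • g - eb N i‖ ^ 2 =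
      a ^ 2 * ‖L (eb N i)‖ ^ 2 + (c ^ 2 * q ^ 2 + 2 * a * c * q) * ⟪p, eb N i⟫ ^ 2
        - 2 * a * ⟪L (eb N i), eb N i⟫ - 2 * c * (⟪p, eb N i⟫ * ⟪g, eb N i⟫) + 1 := by
    have he : ‖eb N i‖ = 1 := by simp [eb]
    rw [norm_sub_sq_real, norm_add_sq_real, inner_add_left]
    simp only [norm_smul, inner_smul_left, inner_smul_right, mul_pow, ← hL, he, hq,
      Real.norm_eq_abs, sq_abs, conj_trivial]
    ring
  simp only [hsq, key, Finset.sum_add_distrib, Finset.sum_sub_distrib, ← Finset.mul_sum, hpg]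
  simp

/-- The derivative of `(ψ(q)/q) ∇u`. -/
theorem hasFDerivAt_smul_gradient {N : ℕ} {u : EuclideanSpace ℝ (Fin N) → ℝ}
    {x : EuclideanSpace ℝ (Fin N)} (hG : DifferentiableAt ℝ (gradient u) x)
    (h0 : gradient u x ≠ 0) {ψ : ℝ → ℝ} (hψ : DifferentiableAt ℝ ψ (qf u x)) :
    HasFDerivAt (fun y => (ψ (qf u y) / qf u y) • gradient u y)
      ((ψ (qf u x) / qf u x) • fderiv ℝ (gradient u) x +
        (((deriv ψ (qf u x) * qf u x - ψ (qf u x)) / qf u x ^ 2) • fderiv ℝ (qf u) x).smulRight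
          (gradient u x)) x := by
  have hq : DifferentiableAt ℝ (qf u) x := hG.norm ℝ h0
  have hq0 : qf u x ≠ 0 := norm_ne_zero_iff.mpr h0
  have hd := hψ.hasDerivAt.div (hasDerivAt_id (qf u x)) hq0
  simp only [id, mul_one] at hd
  exact (hd.comp_hasFDerivAt x hq.hasFDerivAt).smul hG.hasFDerivAt

/-- Equality case of the paper's Lemma 2.2: if equality holds throughout a connected
open set `Ω` in inequality (2.1), then there is `x₀` with
`(ψ(q)/q) ∇u(x) = x − x₀` on `Ω`, and consequently `ψ(q(x))² = |x − x₀|²` on `Ω`. -/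
theorem stmt2 (N : ℕ) (Ω : Set (EuclideanSpace ℝ (Fin N))) (hΩ : IsOpen Ω)
    (hconn : IsConnected Ω)
    (u : EuclideanSpace ℝ (Fin N) → ℝ) (hu : ContDiffOn ℝ 2 u Ω)
    (hgrad : ∀ x ∈ Ω, gradient u x ≠ 0)
    (ψ : ℝ → ℝ) (hψ : ContDiffOn ℝ 1 ψ (Ioi 0))
    (heq : ∀ x ∈ Ω,
      (ψ (qf u x))^2 * (∑ i, ∑ h, (pd2 u x i h)^2) =
        ((ψ (qf u x))^2 - (deriv ψ (qf u x))^2 * (qf u x)^2) * ‖gradient (qf u) x‖^2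
        + (2 * deriv ψ (qf u x) * qf u x - 2 * ψ (qf u x)) * ⟪gradient (qf u) x, gradient u x⟫
        - (N : ℝ) * (qf u x)^2 + 2 * ψ (qf u x) * qf u x * lap u x) :
    ∃ x₀ : EuclideanSpace ℝ (Fin N), ∀ x ∈ Ω,
      (ψ (qf u x) / qf u x) • gradient u x = x - x₀ ∧
      (ψ (qf u x))^2 = ‖x - x₀‖^2 := by
  have hder : ∀ x ∈ Ω, HasFDerivAt (fun y => (ψ (qf u y) / qf u y) • gradient u y)
      (ContinuousLinearMap.id ℝ (EuclideanSpace ℝ (Fin N))) x := by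
    intro x hx
    have hG := differentiableAt_gradient hΩ hu hx
    have hq : 0 < qf u x := norm_pos_iff.mpr (hgrad x hx)
    have hψx : DifferentiableAt ℝ ψ (qf u x) :=
      (hψ.differentiableOn (by norm_num)).differentiableAt (Ioi_mem_nhds hq)
    have hsum := sum_norm_sq_rank_one_perturbation_sub_id (fderiv ℝ (gradient u) x)
      (gradient u x) (gradient (qf u) x) (qf u x) (ψ (qf u x) / qf u x)
      ((deriv ψ (qf u x) * qf u x - ψ (qf u x)) / qf u x ^ 2) rfl
      (qf_mul_inner_gradient_qf hG (hgrad x hx))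
    have he := heq x hx
    simp only [lap, pd2_eq_inner hG] at he
    have hzero := hsum.trans (b := _) (c := 0) (by
      field_simp
      linear_combination he)
    rw [Finset.sum_eq_zero_iff_of_nonneg (fun i _ => by positivity)] at hzero
    convert hasFDerivAt_smul_gradient hG (hgrad x hx) hψx using 1
    refine ContinuousLinearMap.coe_injective
      ((EuclideanSpace.basisFun (Fin N) ℝ).toBasis.ext fun i => ?_)
    have hi := sub_eq_zero.mp (norm_eq_zero.mp (pow_eq_zero_iff two_ne_zero |>.mp
      (hzero i (Finset.mem_univ i))))
    rw [inner_gradient_left] at hi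
    simpa [eb] using hi.symm
  obtain ⟨a, ha⟩ := hΩ.exists_is_const_of_fderiv_eq_zero (𝕜 := ℝ) hconn.isPreconnected
    (f := fun y => (ψ (qf u y) / qf u y) • gradient u y - y)
    (fun x hx => ((hder x hx).sub (hasFDerivAt_id x)).differentiableAt.differentiableWithinAt)
    (fun x hx => ((hder x hx).sub (hasFDerivAt_id x)).fderiv.trans (sub_self _))
  refine ⟨-a, fun x hx => ?_⟩
  have hW : (ψ (qf u x) / qf u x) • gradient u x = x - -a := by
    rw [← ha x hx]
    abel
  refine ⟨hW, ?_⟩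
  have hq : qf u x ≠ 0 := norm_ne_zero_iff.mpr (hgrad x hx)
  rw [← hW, norm_smul, mul_pow, Real.norm_eq_abs, sq_abs]
  change _ = _ * qf u x ^ 2
  field_simp

end
end

section
/- Assume g satisfies conditions (2.4) and h satisfies conditions (2.5), and let N ≥ 1 be an integer. Given t₀ ≥ 0, let φ be the solution of the ODE (t^{N−1} g(φ(t)²) φ(t))' = t^{N−1} h(φ(t)²) with φ(t₀) = 0 (φ continuous at t₀), defined on its maximal interval of existence (t₀, t₁), where t₁ may be finite or ∞. Then φ'(t) > 0 for all t ∈ (t₀, t₁), and φ(t) → ∞ as t → t₁⁻. -/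
open Set Filter

noncomputable section

/-- `G(ξ) = g(ξ) + 2ξ g'(ξ)`, from (1.2). -/
def Gfun (g : ℝ → ℝ) (ξ : ℝ) : ℝ := g ξ + 2 * ξ * deriv g ξ

/-- Conditions (2.4) on `g`: smooth and positive on `(0,∞)`, `g(ξ²)ξ → 0` as `ξ → 0⁺`,
`g(ξ²)ξ → ∞` as `ξ → ∞`, and `G > 0` on `(0,∞)`. -/
def Cond24 (g : ℝ → ℝ) : Prop :=
  ContDiffOn ℝ (⊤ : ℕ∞) g (Ioi 0) ∧ (∀ ξ > (0:ℝ), 0 < g ξ) ∧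
  Tendsto (fun ξ : ℝ => g (ξ ^ 2) * ξ) (nhdsWithin 0 (Ioi 0)) (nhds 0) ∧
  Tendsto (fun ξ : ℝ => g (ξ ^ 2) * ξ) atTop atTop ∧
  (∀ ξ > (0:ℝ), 0 < Gfun g ξ)

/-- Conditions (2.5) on `h`: smooth on `[0,∞)` with `h > 0` and `h' ≥ 0`. -/
def Cond25 (h : ℝ → ℝ) : Prop :=
  ContDiffOn ℝ (⊤ : ℕ∞) h (Ici 0) ∧ (∀ ξ ≥ (0:ℝ), 0 < h ξ) ∧
  (∀ ξ ≥ (0:ℝ), 0 ≤ derivWithin h (Ici 0) ξ)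

/-- `φ` is a (differentiable) solution of the ODE
`(t^{N−1} g(φ²) φ)' = t^{N−1} h(φ²)` (equation (2.6)) on the set `s`. -/
def SolOn (N : ℕ) (g h φ : ℝ → ℝ) (s : Set ℝ) : Prop :=
  DifferentiableOn ℝ φ s ∧
  ∀ t ∈ s, HasDerivAt (fun τ : ℝ => τ ^ (N - 1) * (g (φ τ ^ 2) * φ τ))
    (t ^ (N - 1) * h (φ t ^ 2)) t

/-- The open interval `(t₀, t₁)` where `t₁` may be `∞` (an extended real). -/
def Iint (t₀ : ℝ) (t₁ : EReal) : Set ℝ := {t : ℝ | t₀ < t ∧ (t : EReal) < t₁}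

/-- The right-hand side of the equation for `φ` solved for `φ'`, with `n = N - 1`. -/
def odeRHS (n : ℕ) (g h : ℝ → ℝ) (t x : ℝ) : ℝ :=
  (h (x ^ 2) - n / t * (g (x ^ 2) * x)) / Gfun g (x ^ 2)

lemma Cond24.hasDerivAt_flux {g : ℝ → ℝ} (hg : Cond24 g) {x : ℝ} (hx : 0 < x) :
    HasDerivAt (fun ξ : ℝ => g (ξ ^ 2) * ξ) (Gfun g (x ^ 2)) x := by
  have hx2 : 0 < x ^ 2 := by positivity
  have hd : HasDerivAt g (deriv g (x ^ 2)) (x ^ 2) :=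
    ((hg.1.contDiffAt (Ioi_mem_nhds hx2)).differentiableAt (by simp)).hasDerivAt
  have hsq : HasDerivAt (fun ξ : ℝ => ξ ^ 2) (2 * x) x := by simpa using hasDerivAt_pow 2 x
  refine ((HasDerivAt.comp (h := fun ξ : ℝ => ξ ^ 2) x hd hsq).mul (hasDerivAt_id x)).congr_deriv ?_
  simp only [Gfun, Function.comp, id]
  ring

lemma Cond24.tendsto_flux_zero {g : ℝ → ℝ} (hg : Cond24 g) :
    Tendsto (fun ξ : ℝ => g (ξ ^ 2) * ξ) (nhds 0) (nhds 0) := by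
  have hr := hg.2.2.1
  have hl : Tendsto (fun ξ : ℝ => g (ξ ^ 2) * ξ) (nhdsWithin 0 (Iio 0)) (nhds 0) := by
    have hneg : Tendsto (fun ξ : ℝ => -ξ) (nhdsWithin 0 (Iio 0)) (nhdsWithin 0 (Ioi 0)) := by
      simpa using tendsto_neg_nhdsLT (a := (0 : ℝ))
    simpa using (hr.comp hneg).neg
  have hc : ContinuousAt (fun ξ : ℝ => g (ξ ^ 2) * ξ) 0 :=
    continuousAt_iff_continuous_left'_right'.2
      ⟨by simpa [ContinuousWithinAt] using hl, by simpa [ContinuousWithinAt] using hr⟩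
  simpa [ContinuousAt] using hc

lemma Cond25.monotoneOn {h : ℝ → ℝ} (hh : Cond25 h) : MonotoneOn h (Ici 0) := by
  refine monotoneOn_of_deriv_nonneg (convex_Ici 0) hh.1.continuousOn ?_ ?_
  · exact (hh.1.differentiableOn (by simp)).mono interior_subset
  · intro x hx
    rw [interior_Ici] at hx
    rw [← derivWithin_of_mem_nhds (Ici_mem_nhds hx)]
    exact hh.2.2 x (le_of_lt hx)

lemma Cond24.contDiffAt_odeRHS {g h : ℝ → ℝ} (hg : Cond24 g) (hh : Cond25 h) (n : ℕ) {t x : ℝ}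
    (ht : t ≠ 0) (hx : 0 < x) :
    ContDiffAt ℝ 1 (fun p : ℝ × ℝ => odeRHS n g h p.1 p.2) (t, x) := by
  have hx2 : 0 < x ^ 2 := by positivity
  have hsq : ContDiffAt ℝ 1 (fun p : ℝ × ℝ => p.2 ^ 2) (t, x) := by fun_prop
  have hg1 : ContDiffAt ℝ 1 g (x ^ 2) := (hg.1.contDiffAt (Ioi_mem_nhds hx2)).of_le (by simp)
  have hg' : ContDiffAt ℝ 1 (deriv g) (x ^ 2) :=
    (hg.1.deriv_of_isOpen isOpen_Ioi (m := 1) (by norm_cast)).contDiffAt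
      (Ioi_mem_nhds hx2)
  have hh1 : ContDiffAt ℝ 1 h (x ^ 2) := (hh.1.contDiffAt (Ici_mem_nhds hx2)).of_le (by simp)
  have hgc := ContDiffAt.comp (t, x) (g := g) (f := fun p : ℝ × ℝ => p.2 ^ 2) hg1 hsq
  have hgc' := ContDiffAt.comp (t, x) (g := deriv g) (f := fun p : ℝ × ℝ => p.2 ^ 2) hg' hsq
  have hhc := ContDiffAt.comp (t, x) (g := h) (f := fun p : ℝ × ℝ => p.2 ^ 2) hh1 hsq
  have hG : ContDiffAt ℝ 1 (fun p : ℝ × ℝ => Gfun g (p.2 ^ 2)) (t, x) :=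
    hgc.add ((contDiffAt_const.mul hsq).mul hgc')
  have hdiv : ContDiffAt ℝ 1 (fun p : ℝ × ℝ => (n : ℝ) / p.1) (t, x) :=
    contDiffAt_const.div contDiffAt_fst ht
  exact (hhc.sub (hdiv.mul (hgc.mul contDiffAt_snd))).div hG (hg.2.2.2.2 _ hx2).ne'

lemma Cond24.hasDerivAt_weighted_flux {g : ℝ → ℝ} (hg : Cond24 g) (n : ℕ) {φ : ℝ → ℝ} {t d : ℝ}
    (ht : 0 < t) (hφt : 0 < φ t) (hd : HasDerivAt φ d t) :
    HasDerivAt (fun τ : ℝ => τ ^ n * (g (φ τ ^ 2) * φ τ))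
      (t ^ n * (n / t * (g (φ t ^ 2) * φ t) + Gfun g (φ t ^ 2) * d)) t := by
  refine ((hasDerivAt_pow n t).mul
    (HasDerivAt.comp t (hg.hasDerivAt_flux hφt) hd)).congr_deriv ?_
  have hn : (n : ℝ) * t ^ (n - 1) = t ^ n * (n / t) := by
    rcases n with _ | n
    · simp
    · field_simp
      simp [pow_succ]
  simp only [Function.comp, hn]
  ring

lemma Iint.mem_of_le {t₀ : ℝ} {t₁ : EReal} {s t : ℝ} (ht : t ∈ Iint t₀ t₁) (hs : t₀ < s)
    (hst : s ≤ t) : s ∈ Iint t₀ t₁ :=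
  ⟨hs, lt_of_le_of_lt (by exact_mod_cast hst) ht.2⟩

lemma SolOn.of_hasDerivAt {N : ℕ} {g h φ : ℝ → ℝ} {s : Set ℝ} (hg : Cond24 g)
    (hφ : ∀ t ∈ s, 0 < t ∧ 0 < φ t ∧ HasDerivAt φ (odeRHS (N - 1) g h t (φ t)) t) :
    SolOn N g h φ s := by
  refine ⟨fun t ht => (hφ t ht).2.2.differentiableAt.differentiableWithinAt, fun t ht => ?_⟩
  obtain ⟨ht0, hpos, hd⟩ := hφ t ht
  refine (hg.hasDerivAt_weighted_flux (N - 1) ht0 hpos hd).congr_deriv ?_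
  have hG := (hg.2.2.2.2 (φ t ^ 2) (by positivity)).ne'
  rw [odeRHS, mul_div_cancel₀ _ hG]
  ring

lemma isOpen_Iint (t₀ : ℝ) (t₁ : EReal) : IsOpen (Iint t₀ t₁) :=
  isOpen_Ioi.inter (isOpen_Iio.preimage continuous_coe_real_ereal)

section Solution

variable {N : ℕ} {g h φ : ℝ → ℝ} {t₀ : ℝ} {t₁ : EReal}

lemma SolOn.continuousOn_Icc (hsol : SolOn N g h φ (Iint t₀ t₁)) (hinit : φ t₀ = 0)
    (hcont : Tendsto φ (nhdsWithin t₀ (Ioi t₀)) (nhds 0)) {t : ℝ} (ht : t ∈ Iint t₀ t₁) :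
    ContinuousOn φ (Icc t₀ t) := by
  intro s hs
  rcases hs.1.eq_or_lt with rfl | hlt
  · have : ContinuousWithinAt φ (Ioi t₀) t₀ := by rwa [ContinuousWithinAt, hinit]
    exact (continuousWithinAt_Ioi_iff_Ici.1 this).mono Icc_subset_Ici_self
  · exact (hsol.1.differentiableAt ((isOpen_Iint t₀ t₁).mem_nhds
      (Iint.mem_of_le ht hlt hs.2))).continuousAt.continuousWithinAt

lemma SolOn.continuousOn_flux (hg : Cond24 g) (hsol : SolOn N g h φ (Iint t₀ t₁))
    (hinit : φ t₀ = 0) (hcont : Tendsto φ (nhdsWithin t₀ (Ioi t₀)) (nhds 0)) {t : ℝ}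
    (ht : t ∈ Iint t₀ t₁) :
    ContinuousOn (fun τ : ℝ => τ ^ (N - 1) * (g (φ τ ^ 2) * φ τ)) (Icc t₀ t) := by
  intro s hs
  rcases hs.1.eq_or_lt with rfl | hlt
  · have hA : ContinuousAt (fun ξ : ℝ => g (ξ ^ 2) * ξ) (φ t₀) := by
      rw [hinit]
      simpa [ContinuousAt] using hg.tendsto_flux_zero
    exact (continuous_pow _).continuousWithinAt.mul
      (hA.comp_continuousWithinAt (hsol.continuousOn_Icc hinit hcont ht t₀ hs))
  · exact (hsol.2 s (Iint.mem_of_le ht hlt hs.2)).continuousAt.continuousWithinAt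

lemma SolOn.pos (hg : Cond24 g) (hh : Cond25 h) (ht₀ : 0 ≤ t₀)
    (hsol : SolOn N g h φ (Iint t₀ t₁)) (hinit : φ t₀ = 0)
    (hcont : Tendsto φ (nhdsWithin t₀ (Ioi t₀)) (nhds 0)) {t : ℝ} (ht : t ∈ Iint t₀ t₁) :
    0 < φ t := by
  have htpos : 0 < t := ht₀.trans_lt ht.1
  have hmono : StrictMonoOn (fun τ : ℝ => τ ^ (N - 1) * (g (φ τ ^ 2) * φ τ)) (Icc t₀ t) := by
    refine strictMonoOn_of_deriv_pos (convex_Icc _ _)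
      (hsol.continuousOn_flux hg hinit hcont ht) fun s hs => ?_
    rw [interior_Icc] at hs
    rw [(hsol.2 s (Iint.mem_of_le ht hs.1 hs.2.le)).deriv]
    exact mul_pos (pow_pos (ht₀.trans_lt hs.1) _) (hh.2.1 _ (sq_nonneg _))
  have hlt := hmono (left_mem_Icc.2 ht.1.le) (right_mem_Icc.2 ht.1.le) ht.1
  simp only [hinit, mul_zero] at hlt
  have hA : 0 < g (φ t ^ 2) * φ t := pos_of_mul_pos_right hlt (pow_pos htpos _).le
  by_contra! hle
  rcases hle.eq_or_lt with h0 | hneg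
  · simp [h0] at hA
  · exact absurd hA (not_lt.2 (mul_nonpos_of_nonneg_of_nonpos
      (hg.2.1 _ (sq_pos_of_neg hneg)).le hle))

lemma SolOn.hasDerivAt (hg : Cond24 g) (hh : Cond25 h) (ht₀ : 0 ≤ t₀)
    (hsol : SolOn N g h φ (Iint t₀ t₁)) (hinit : φ t₀ = 0)
    (hcont : Tendsto φ (nhdsWithin t₀ (Ioi t₀)) (nhds 0)) {t : ℝ} (ht : t ∈ Iint t₀ t₁) :
    HasDerivAt φ (odeRHS (N - 1) g h t (φ t)) t := by
  have htpos : 0 < t := ht₀.trans_lt ht.1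
  have hpos := hsol.pos hg hh ht₀ hinit hcont ht
  have hd := (hsol.1.differentiableAt ((isOpen_Iint t₀ t₁).mem_nhds ht)).hasDerivAt
  have heq := (hg.hasDerivAt_weighted_flux (N - 1) htpos hpos hd).unique (hsol.2 t ht)
  have heq' := mul_left_cancel₀ (pow_pos htpos _).ne' heq
  have hG := hg.2.2.2.2 (φ t ^ 2) (by positivity)
  have hval : odeRHS (N - 1) g h t (φ t) = deriv φ t := by
    rw [odeRHS, div_eq_iff hG.ne', ← heq']
    ring
  exact hval ▸ hd

/-- At a point where `φ` dominates its past, the numerator of `odeRHS` is at least `h(φ²)/N`. -/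
lemma SolOn.div_le_of_forall_le (hN : 1 ≤ N) (hg : Cond24 g) (hh : Cond25 h) (ht₀ : 0 ≤ t₀)
    (hsol : SolOn N g h φ (Iint t₀ t₁)) (hinit : φ t₀ = 0)
    (hcont : Tendsto φ (nhdsWithin t₀ (Ioi t₀)) (nhds 0)) {t : ℝ} (ht : t ∈ Iint t₀ t₁)
    (hle : ∀ s ∈ Ioo t₀ t, φ s ≤ φ t) :
    h (φ t ^ 2) / N ≤ h (φ t ^ 2) - (N - 1 : ℕ) / t * (g (φ t ^ 2) * φ t) := by
  obtain ⟨n, rfl⟩ : ∃ n, N = n + 1 := ⟨N - 1, by omega⟩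
  simp only [Nat.add_sub_cancel] at *
  have htpos : 0 < t := ht₀.trans_lt ht.1
  have hn : (0 : ℝ) < (n + 1 : ℕ) := by positivity
  set H := h (φ t ^ 2) with hH
  have hHpos : 0 < H := hh.2.1 _ (sq_nonneg _)
  have hanti : AntitoneOn (fun τ : ℝ => τ ^ n * (g (φ τ ^ 2) * φ τ) -
      H / (n + 1 : ℕ) * τ ^ (n + 1)) (Icc t₀ t) := by
    have hder : ∀ s ∈ Ioo t₀ t, HasDerivAt (fun τ : ℝ => τ ^ n * (g (φ τ ^ 2) * φ τ) -
        H / (n + 1 : ℕ) * τ ^ (n + 1)) (s ^ n * (h (φ s ^ 2) - H)) s := by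
      intro s hs
      refine ((hsol.2 s (Iint.mem_of_le ht hs.1 hs.2.le)).sub
        ((hasDerivAt_pow (n + 1) s).const_mul _)).congr_deriv ?_
      simp only [Nat.add_sub_cancel]
      field_simp
    refine antitoneOn_of_deriv_nonpos (convex_Icc _ _)
      ((hsol.continuousOn_flux hg hinit hcont ht).sub (by fun_prop)) ?_ ?_
    · rw [interior_Icc]
      exact fun s hs => (hder s hs).differentiableAt.differentiableWithinAt
    · rw [interior_Icc]
      intro s hs
      rw [(hder s hs).deriv]
      have hs0 : 0 < φ s := hsol.pos hg hh ht₀ hinit hcont (Iint.mem_of_le ht hs.1 hs.2.le)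
      have hle' : h (φ s ^ 2) ≤ H :=
        hh.monotoneOn (sq_nonneg (φ s)) (sq_nonneg (φ t)) (by gcongr; exact hle s hs)
      exact mul_nonpos_of_nonneg_of_nonpos (pow_pos (ht₀.trans_lt hs.1) _).le (by linarith)
  have hend := hanti (left_mem_Icc.2 ht.1.le) (right_mem_Icc.2 ht.1.le) ht.1.le
  simp only [hinit, mul_zero, zero_sub] at hend
  have hinit_nonneg : 0 ≤ H / (n + 1 : ℕ) * t₀ ^ (n + 1) := by positivity
  have hflux : g (φ t ^ 2) * φ t ≤ H / (n + 1 : ℕ) * t := by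
    refine le_of_mul_le_mul_left ?_ (pow_pos htpos n)
    calc t ^ n * (g (φ t ^ 2) * φ t) ≤ H / (n + 1 : ℕ) * t ^ (n + 1) := by linarith
      _ = t ^ n * (H / (n + 1 : ℕ) * t) := by ring
  have hmul : (n : ℝ) / t * (g (φ t ^ 2) * φ t) ≤ n / t * (H / (n + 1 : ℕ) * t) := by gcongr
  have hval : (n : ℝ) / t * (H / (n + 1 : ℕ) * t) = H - H / (n + 1 : ℕ) := by
    push_cast
    field_simp
    ring
  linarith

lemma SolOn.le_of_mem_Ioo (hN : 1 ≤ N) (hg : Cond24 g) (hh : Cond25 h) (ht₀ : 0 ≤ t₀)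
    (hsol : SolOn N g h φ (Iint t₀ t₁)) (hinit : φ t₀ = 0)
    (hcont : Tendsto φ (nhdsWithin t₀ (Ioi t₀)) (nhds 0)) {t : ℝ} (ht : t ∈ Iint t₀ t₁)
    {s : ℝ} (hs : s ∈ Ioo t₀ t) : φ s ≤ φ t := by
  obtain ⟨m, hm, hmax⟩ := isCompact_Icc.exists_isMaxOn (nonempty_Icc.2 ht.1.le)
    (hsol.continuousOn_Icc hinit hcont ht)
  have hmt : φ t ≤ φ m := hmax (right_mem_Icc.2 ht.1.le)
  have hm0 : t₀ < m := by
    refine lt_of_le_of_ne hm.1 ?_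
    rintro rfl
    linarith [hsol.pos hg hh ht₀ hinit hcont ht]
  have hmI := Iint.mem_of_le ht hm0 hm.2
  rcases hm.2.eq_or_lt with rfl | hlt
  · exact hmax ⟨hs.1.le, hs.2.le⟩
  · have hloc : IsLocalMax φ m := hmax.isLocalMax (Icc_mem_nhds hm0 hlt)
    have hzero := hloc.hasDerivAt_eq_zero (hsol.hasDerivAt hg hh ht₀ hinit hcont hmI)
    have hmpos := hsol.pos hg hh ht₀ hinit hcont hmI
    have hG := hg.2.2.2.2 (φ m ^ 2) (by positivity)
    have hH : 0 < h (φ m ^ 2) / N :=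
      div_pos (hh.2.1 _ (sq_nonneg _)) (by exact_mod_cast hN)
    have hb := hsol.div_le_of_forall_le hN hg hh ht₀ hinit hcont hmI
      fun r hr => hmax ⟨hr.1.le, hr.2.le.trans hm.2⟩
    exact absurd hzero (div_pos (hH.trans_le hb) hG).ne'

lemma SolOn.div_le (hN : 1 ≤ N) (hg : Cond24 g) (hh : Cond25 h) (ht₀ : 0 ≤ t₀)
    (hsol : SolOn N g h φ (Iint t₀ t₁)) (hinit : φ t₀ = 0)
    (hcont : Tendsto φ (nhdsWithin t₀ (Ioi t₀)) (nhds 0)) {t : ℝ} (ht : t ∈ Iint t₀ t₁) :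
    h (φ t ^ 2) / N ≤ h (φ t ^ 2) - (N - 1 : ℕ) / t * (g (φ t ^ 2) * φ t) :=
  hsol.div_le_of_forall_le hN hg hh ht₀ hinit hcont ht fun _ hs =>
    hsol.le_of_mem_Ioo hN hg hh ht₀ hinit hcont ht hs

lemma SolOn.deriv_pos (hN : 1 ≤ N) (hg : Cond24 g) (hh : Cond25 h) (ht₀ : 0 ≤ t₀)
    (hsol : SolOn N g h φ (Iint t₀ t₁)) (hinit : φ t₀ = 0)
    (hcont : Tendsto φ (nhdsWithin t₀ (Ioi t₀)) (nhds 0)) {t : ℝ} (ht : t ∈ Iint t₀ t₁) :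
    0 < deriv φ t := by
  rw [(hsol.hasDerivAt hg hh ht₀ hinit hcont ht).deriv]
  have hpos := hsol.pos hg hh ht₀ hinit hcont ht
  have hH : 0 < h (φ t ^ 2) / N := div_pos (hh.2.1 _ (sq_nonneg _)) (by exact_mod_cast hN)
  exact div_pos (hH.trans_le (hsol.div_le hN hg hh ht₀ hinit hcont ht))
    (hg.2.2.2.2 _ (by positivity))

lemma SolOn.monotoneOn (hN : 1 ≤ N) (hg : Cond24 g) (hh : Cond25 h) (ht₀ : 0 ≤ t₀)
    (hsol : SolOn N g h φ (Iint t₀ t₁)) (hinit : φ t₀ = 0)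
    (hcont : Tendsto φ (nhdsWithin t₀ (Ioi t₀)) (nhds 0)) : MonotoneOn φ (Iint t₀ t₁) := by
  intro s hs t ht hst
  rcases hst.eq_or_lt with rfl | hlt
  · rfl
  · exact hsol.le_of_mem_Ioo hN hg hh ht₀ hinit hcont ht ⟨hs.1, hlt⟩

/-- The flux `g(φ²)φ` grows at least linearly. -/
lemma SolOn.linear_le_flux (hN : 1 ≤ N) (hg : Cond24 g) (hh : Cond25 h) (ht₀ : 0 ≤ t₀)
    (hsol : SolOn N g h φ (Iint t₀ t₁)) (hinit : φ t₀ = 0)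
    (hcont : Tendsto φ (nhdsWithin t₀ (Ioi t₀)) (nhds 0)) {s t : ℝ} (hs : t₀ < s)
    (hst : s ≤ t) (ht : t ∈ Iint t₀ t₁) :
    h 0 / N * (t - s) ≤ g (φ t ^ 2) * φ t := by
  have hd : ∀ r ∈ Icc s t, HasDerivAt (fun τ : ℝ => g (φ τ ^ 2) * φ τ)
      (Gfun g (φ r ^ 2) * odeRHS (N - 1) g h r (φ r)) r := fun r hr => by
    have hrI := Iint.mem_of_le ht (hs.trans_le hr.1) hr.2
    exact HasDerivAt.comp r (hg.hasDerivAt_flux (hsol.pos hg hh ht₀ hinit hcont hrI))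
      (hsol.hasDerivAt hg hh ht₀ hinit hcont hrI)
  have hmv := (convex_Icc s t).mul_sub_le_image_sub_of_le_deriv (C := h 0 / N)
    (f := fun τ : ℝ => g (φ τ ^ 2) * φ τ)
    (fun r hr => (hd r hr).continuousAt.continuousWithinAt)
    (fun r hr => (hd r (interior_subset hr)).differentiableAt.differentiableWithinAt)
    (fun r hr => by
      have hr' := interior_subset hr
      have hrI := Iint.mem_of_le ht (hs.trans_le hr'.1) hr'.2
      have hpos := hsol.pos hg hh ht₀ hinit hcont hrI
      rw [(hd r hr').deriv, odeRHS, mul_div_cancel₀ _ (hg.2.2.2.2 _ (by positivity)).ne']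
      refine le_trans ?_ (hsol.div_le hN hg hh ht₀ hinit hcont hrI)
      gcongr
      exact hh.monotoneOn self_mem_Ici (sq_nonneg (φ r)) (sq_nonneg (φ r)))
    s (left_mem_Icc.2 hst) t (right_mem_Icc.2 hst) hst
  have hsI := Iint.mem_of_le ht hs hst
  have hspos := hsol.pos hg hh ht₀ hinit hcont hsI
  have hflux_pos : 0 < g (φ s ^ 2) * φ s := mul_pos (hg.2.1 _ (by positivity)) hspos
  linarith

lemma SolOn.not_bddAbove_of_top (hN : 1 ≤ N) (hg : Cond24 g) (hh : Cond25 h) (ht₀ : 0 ≤ t₀)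
    (hsol : SolOn N g h φ (Iint t₀ ⊤)) (hinit : φ t₀ = 0)
    (hcont : Tendsto φ (nhdsWithin t₀ (Ioi t₀)) (nhds 0)) :
    ¬ BddAbove (φ '' Iint t₀ ⊤) := by
  rintro ⟨M, hM⟩
  have hmem : ∀ {t : ℝ}, t₀ < t → t ∈ Iint t₀ ⊤ := fun ht => ⟨ht, EReal.coe_lt_top _⟩
  have h1 : t₀ < t₀ + 1 := by linarith
  have hpos := hsol.pos hg hh ht₀ hinit hcont (hmem h1)
  obtain ⟨B, hB⟩ := (isCompact_Icc (a := φ (t₀ + 1)) (b := M)).bddAbove_image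
    (f := fun ξ : ℝ => g (ξ ^ 2) * ξ)
    fun x hx => (hg.hasDerivAt_flux (hpos.trans_le hx.1)).continuousAt.continuousWithinAt
  have hc : 0 < h 0 / N := div_pos (hh.2.1 0 le_rfl) (by exact_mod_cast hN)
  set t := t₀ + 1 + (|B| + 1) / (h 0 / N) with ht
  have hle : t₀ + 1 ≤ t := by
    rw [ht]
    have : 0 ≤ (|B| + 1) / (h 0 / N) := by positivity
    linarith
  have htI := hmem (h1.trans_le hle)
  have hlin := hsol.linear_le_flux hN hg hh ht₀ hinit hcont h1 hle htI
  have hbd : g (φ t ^ 2) * φ t ≤ B := hB ⟨φ t,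
    ⟨hsol.monotoneOn hN hg hh ht₀ hinit hcont (hmem h1) htI hle, hM ⟨t, htI, rfl⟩⟩, rfl⟩
  have hval : h 0 / N * (t - (t₀ + 1)) = |B| + 1 := by
    rw [ht, add_sub_cancel_left, mul_div_cancel₀ _ hc.ne']
  linarith [le_abs_self B]

end Solution

/-- Local existence for the non-autonomous equation `x' = odeRHS t x` at a positive value. -/
lemma exists_hasDerivAt_odeRHS {g h : ℝ → ℝ} (hg : Cond24 g) (hh : Cond25 h) (n : ℕ) {T L : ℝ}
    (hT : 0 < T) (hL : 0 < L) :
    ∃ α : ℝ → ℝ, α T = L ∧ ∃ ε > 0, ∀ t ∈ Ioo (T - ε) (T + ε),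
      0 < α t ∧ HasDerivAt α (odeRHS n g h t (α t)) t := by
  obtain ⟨β, hβT, ε, hε, hβ⟩ :=
    ContDiffAt.exists_forall_mem_closedBall_exists_eq_forall_mem_Ioo_hasDerivAt₀
      (f := fun p : ℝ × ℝ => ((1 : ℝ), odeRHS n g h p.1 p.2))
      (contDiffAt_const.prodMk (hg.contDiffAt_odeRHS hh n hT.ne' hL)) T
  have hTmem : T ∈ Ioo (T - ε) (T + ε) := ⟨by linarith, by linarith⟩
  have hfst : ∀ t ∈ Ioo (T - ε) (T + ε), (β t).1 = t := by
    have hconst : ∀ t ∈ Ioo (T - ε) (T + ε),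
        HasDerivAt (fun τ => (β τ).1 - τ) 0 t := fun t ht => by
      simpa using (hβ t ht).hasFDerivAt.fst.hasDerivAt.fun_sub (hasDerivAt_id' t)
    intro t ht
    have := isOpen_Ioo.is_const_of_deriv_eq_zero isPreconnected_Ioo
      (fun s hs => (hconst s hs).differentiableAt.differentiableWithinAt)
      (fun s hs => (hconst s hs).deriv) ht hTmem
    simp only [hβT, sub_self] at this
    linarith
  have hsnd : ∀ t ∈ Ioo (T - ε) (T + ε),
      HasDerivAt (fun τ => (β τ).2) (odeRHS n g h t (β t).2) t := fun t ht => by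
    simpa [hfst t ht] using (hβ t ht).hasFDerivAt.snd.hasDerivAt
  have hev : ∀ᶠ t in nhds T, 0 < (β t).2 :=
    (hsnd T hTmem).continuousAt.eventually (lt_mem_nhds (by simpa [hβT] using hL))
  obtain ⟨δ, hδ, hball⟩ := Metric.eventually_nhds_iff.1 hev
  refine ⟨fun t => (β t).2, by simp [hβT], min ε δ, lt_min hε hδ, fun t ht => ⟨hball ?_, ?_⟩⟩
  · rw [Real.dist_eq, abs_lt]
    exact ⟨by linarith [ht.1, min_le_right ε δ], by linarith [ht.2, min_le_right ε δ]⟩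
  · exact hsnd t ⟨by linarith [ht.1, min_le_left ε δ], by linarith [ht.2, min_le_left ε δ]⟩

/-- A bounded solution on a finite interval extends beyond the right endpoint. -/
lemma SolOn.exists_extension {N : ℕ} {g h φ : ℝ → ℝ} {t₀ T : ℝ} (hN : 1 ≤ N) (hg : Cond24 g)
    (hh : Cond25 h) (ht₀ : 0 ≤ t₀) (hT : t₀ < T) (hsol : SolOn N g h φ (Iint t₀ T))
    (hinit : φ t₀ = 0) (hcont : Tendsto φ (nhdsWithin t₀ (Ioi t₀)) (nhds 0))
    (hbdd : BddAbove (φ '' Iint t₀ T)) :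
    ∃ T₂ : ℝ, T < T₂ ∧ ∃ φ₂ : ℝ → ℝ, SolOn N g h φ₂ (Iint t₀ T₂) ∧
      Tendsto φ₂ (nhdsWithin t₀ (Ioi t₀)) (nhds 0) ∧ EqOn φ φ₂ (Iint t₀ T) := by
  have hI : ∀ b : ℝ, Iint t₀ b = Ioo t₀ b := fun b => by
    ext t
    simp [Iint]
  have hmono := hsol.monotoneOn hN hg hh ht₀ hinit hcont
  have hpos : ∀ t ∈ Ioo t₀ T, 0 < φ t := fun t ht =>
    hsol.pos hg hh ht₀ hinit hcont (hI T ▸ ht)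
  have hder : ∀ t ∈ Ioo t₀ T, HasDerivAt φ (odeRHS (N - 1) g h t (φ t)) t := fun t ht =>
    hsol.hasDerivAt hg hh ht₀ hinit hcont (hI T ▸ ht)
  rw [hI] at hmono hbdd
  have hTpos : 0 < T := ht₀.trans_lt hT
  have hlim := hmono.tendsto_nhdsWithin_Ioo_left (nonempty_Ioo.2 hT) hbdd
  set L := sSup (φ '' Ioo t₀ T) with hLdef
  obtain ⟨c, hc⟩ := nonempty_Ioo.2 hT
  have hL : 0 < L := (hpos c hc).trans_le (le_csSup hbdd ⟨c, hc, rfl⟩)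
  obtain ⟨α, hαT, ε, hε, hα⟩ := exists_hasDerivAt_odeRHS hg hh (N - 1) hTpos hL
  set φ₂ : ℝ → ℝ := fun t => if t < T then φ t else α t with hφ₂
  have hleft : EqOn φ₂ φ (Iio T) := fun t ht => if_pos ht
  have hright : EqOn φ₂ α (Ici T) := fun t ht => if_neg (not_lt.2 ht)
  have hφ₂T : φ₂ T = L := (hright self_mem_Ici).trans hαT
  have hlt : ∀ t ∈ Ioo t₀ T, HasDerivAt φ₂ (odeRHS (N - 1) g h t (φ₂ t)) t := fun t ht => by
    rw [hleft ht.2]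
    exact (hder t ht).congr_of_eventuallyEq (hleft.eventuallyEq_of_mem (Iio_mem_nhds ht.2))
  have hlim₂ : Tendsto φ₂ (nhdsWithin T (Iio T)) (nhds L) :=
    hlim.congr' (hleft.symm.eventuallyEq_of_mem self_mem_nhdsWithin)
  have hlimder : Tendsto (deriv φ₂) (nhdsWithin T (Iio T))
      (nhds (odeRHS (N - 1) g h T L)) := by
    have hpair : Tendsto (fun t => (t, φ₂ t)) (nhdsWithin T (Iio T)) (nhds (T, L)) :=
      (tendsto_id.mono_left nhdsWithin_le_nhds).prodMk_nhds hlim₂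
    refine ((hg.contDiffAt_odeRHS hh (N - 1) hTpos.ne' hL).continuousAt.tendsto.comp
      hpair).congr' ?_
    filter_upwards [Ioo_mem_nhdsLT hT] with t ht
    exact (hlt t ht).deriv.symm
  have hT' : HasDerivAt φ₂ (odeRHS (N - 1) g h T (φ₂ T)) T := by
    rw [hφ₂T]
    have hl : HasDerivWithinAt φ₂ (odeRHS (N - 1) g h T L) (Iic T) T :=
      hasDerivWithinAt_Iic_of_tendsto_deriv (s := Ioo t₀ T)
        (fun t ht => (hlt t ht).differentiableAt.differentiableWithinAt)
        (by
          rw [ContinuousWithinAt, hφ₂T]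
          exact hlim₂.mono_left (nhdsWithin_mono _ Ioo_subset_Iio_self))
        (Ioo_mem_nhdsLT hT) hlimder
    have hr : HasDerivWithinAt φ₂ (odeRHS (N - 1) g h T L) (Ici T) T := by
      have := (hα T ⟨by linarith, by linarith⟩).2
      rw [hαT] at this
      exact this.hasDerivWithinAt.congr hright (hright self_mem_Ici)
    simpa using hl.union hr
  refine ⟨T + ε, by linarith, φ₂, SolOn.of_hasDerivAt hg fun t ht => ?_, ?_, ?_⟩
  · rw [hI] at ht
    refine ⟨ht₀.trans_lt ht.1, ?_⟩
    rcases lt_trichotomy t T with htT | rfl | htT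
    · exact ⟨(hleft htT).symm ▸ hpos t ⟨ht.1, htT⟩, hlt t ⟨ht.1, htT⟩⟩
    · exact ⟨hφ₂T.symm ▸ hL, hT'⟩
    · obtain ⟨hp, hd⟩ := hα t ⟨by linarith, ht.2⟩
      have hev : φ₂ =ᶠ[nhds t] α := hright.eventuallyEq_of_mem (Ici_mem_nhds htT)
      rw [hright htT.le]
      exact ⟨hp, hd.congr_of_eventuallyEq hev⟩
  · exact hcont.congr' (hleft.symm.eventuallyEq_of_mem
      (mem_nhdsWithin_of_mem_nhds (Iio_mem_nhds hT)))
  · rw [hI]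
    exact fun t ht => (hleft ht.2).symm

/-- Paper's Lemma 2.3: under (2.4) and (2.5), the solution `φ` of (2.6) with
`φ(t₀) = 0` on its maximal interval of existence `(t₀, t₁)` (where `t₁` may be finite
or `∞`) satisfies `φ' > 0` on `(t₀, t₁)` and `φ(t) → ∞` as `t → t₁⁻`. -/
theorem stmt4 (N : ℕ) (hN : 1 ≤ N) (g h : ℝ → ℝ) (hg : Cond24 g) (hh : Cond25 h)
    (t₀ : ℝ) (ht₀ : 0 ≤ t₀) (t₁ : EReal) (ht₁ : (t₀ : EReal) < t₁)
    (φ : ℝ → ℝ)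
    (hsol : SolOn N g h φ (Iint t₀ t₁))
    (hinit : φ t₀ = 0)
    (hcont : Tendsto φ (nhdsWithin t₀ (Ioi t₀)) (nhds 0))
    (hmax : ∀ t₂ : EReal, t₁ < t₂ → ∀ φ₂ : ℝ → ℝ,
      SolOn N g h φ₂ (Iint t₀ t₂) → Tendsto φ₂ (nhdsWithin t₀ (Ioi t₀)) (nhds 0) →
      Set.EqOn φ φ₂ (Iint t₀ t₁) → False) :
    (∀ t ∈ Iint t₀ t₁, 0 < deriv φ t) ∧
    Tendsto φ (Filter.comap (fun t : ℝ => (t : EReal)) (nhdsWithin t₁ (Iio t₁))) atTop := by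
  refine ⟨fun t ht => hsol.deriv_pos hN hg hh ht₀ hinit hcont ht, ?_⟩
  have hunbdd : ¬ BddAbove (φ '' Iint t₀ t₁) := by
    intro hbdd
    induction t₁ with
    | bot => exact not_lt_bot ht₁
    | top => exact hsol.not_bddAbove_of_top hN hg hh ht₀ hinit hcont hbdd
    | coe T =>
      obtain ⟨T₂, hT₂, φ₂, hsol₂, hcont₂, heq⟩ :=
        hsol.exists_extension hN hg hh ht₀ (by exact_mod_cast ht₁) hinit hcont hbdd
      exact hmax T₂ (by exact_mod_cast hT₂) φ₂ hsol₂ hcont₂ heq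
  refine tendsto_atTop.2 fun M => ?_
  obtain ⟨_, ⟨s, hs, rfl⟩, hM⟩ := not_bddAbove_iff.1 hunbdd M
  filter_upwards [preimage_mem_comap (Ioo_mem_nhdsLT hs.2)] with t ht
  have hst : s < t := EReal.coe_lt_coe_iff.1 ht.1
  exact hM.le.trans
    (hsol.monotoneOn hN hg hh ht₀ hinit hcont hs ⟨hs.1.trans hst, ht.2⟩ hst.le)

end
end
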